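/- Let n ≥ 2, let M' be an (n−1)×(n−1) P-matrix, b ∈ ℝ^{n−1}, and let M be the n×n block matrix with upper-left block M', last column (b; 1), and last row (0,…,0,1). Then M is a P-matrix, and for every q ∈ ℝ^n, every vertex v ∈ {0,1}^n with v_n = 1, and every i ∈ [n−1]: (A_{B(v)}(M)^{-1}q)_i = (A_{B(v')}(M')^{-1}(q' − q_n·b))_i, where v' ∈ {0,1}^{n−1} and q' ∈ ℝ^{n−1} consist of the first n−1 coordinates of v and q respectively, and A_{B}(M), A_{B'}(M') are formed from M and M' respectively. Consequently, the orientation induced by LCP(M,q) restricted to the subcube {v ∈ {0,1}^n : v_n = 1}, with the last coordinate dropped, equals the orientation of the (n−1)-cube induced by LCP(M', q' − q_n·b). -/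

import Mathlib

open Matrix BigOperators

/-- A vertex of the `n`-cube: a bit vector of length `n`. -/
abbrev Vertex (n : ℕ) := Fin n → Bool

/-- An orientation of the `n`-cube, given by its "out-map":
`φ v i = true` means that the edge `{v, v ⊕ i}` is directed from `v` to `v ⊕ i`. -/
abbrev CubeOrientation (n : ℕ) := Vertex n → Fin n → Bool

/-- `v ⊕ i`: flip the `i`-th bit of `v`. -/
def vflip {n : ℕ} (v : Vertex n) (i : Fin n) : Vertex n :=
  Function.update v i (!(v i))

/-- `u` belongs to the subcube with base vertex `v` and coordinate set `C`. -/
def InSubcube {n : ℕ} (v : Vertex n) (C : Finset (Fin n)) (u : Vertex n) : Prop :=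
  ∀ j, j ∉ C → u j = v j

/-- `u` is a sink of the subcube `(v, C)`: all subcube edges at `u` are incoming. -/
def IsSink {n : ℕ} (φ : CubeOrientation n) (v : Vertex n) (C : Finset (Fin n))
    (u : Vertex n) : Prop :=
  InSubcube v C u ∧ ∀ i ∈ C, φ u i = false

/-- `u` is a source of the subcube `(v, C)`: all subcube edges at `u` are outgoing. -/
def IsSource {n : ℕ} (φ : CubeOrientation n) (v : Vertex n) (C : Finset (Fin n))
    (u : Vertex n) : Prop :=
  InSubcube v C u ∧ ∀ i ∈ C, φ u i = true

/-- Unique-sink orientation: every subcube has a unique sink. -/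
def IsUSO {n : ℕ} (φ : CubeOrientation n) : Prop :=
  ∀ (v : Vertex n) (C : Finset (Fin n)), ∃! u, IsSink φ v C u

/-- One directed step along an edge of the orientation. -/
def OrientStep {n : ℕ} (φ : CubeOrientation n) (u w : Vertex n) : Prop :=
  ∃ i, φ u i = true ∧ w = vflip u i

/-- Acyclicity: no directed cycle. -/
def IsAcyclic {n : ℕ} (φ : CubeOrientation n) : Prop :=
  ∀ u, ¬ Relation.TransGen (OrientStep φ) u u

/-- Local uniformity of an orientation. -/
def LocallyUniform {n : ℕ} (φ : CubeOrientation n) : Prop :=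
  (∀ (u : Vertex n) (i j : Fin n), i ≠ j → u i = false → u j = false →
      φ u i = true → φ u j = true →
      φ (vflip u i) j = true ∧ φ (vflip u j) i = true) ∧
  (∀ (u : Vertex n) (i j : Fin n), i ≠ j → u i = false → u j = false →
      φ (vflip u i) i = true → φ (vflip u j) j = true →
      φ (vflip (vflip u i) j) j = true ∧ φ (vflip (vflip u j) i) i = true)

/-- `p` is a directed path from `s` to `t` inside the subcube `(v, C)`. -/
def IsDirPathIn {n : ℕ} (φ : CubeOrientation n) (v : Vertex n) (C : Finset (Fin n))
    (s t : Vertex n) (p : List (Vertex n)) : Prop :=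
  p.head? = some s ∧ p.getLast? = some t ∧ p.Nodup ∧
  (∀ u ∈ p, InSubcube v C u) ∧
  p.Chain' (fun a b => ∃ i ∈ C, φ a i = true ∧ b = vflip a i)

/-- The Holt–Klee property: in every subcube of dimension `d`, there are `d` directed
paths from the source to the sink, pairwise sharing no vertex besides source and sink. -/
def HoltKlee {n : ℕ} (φ : CubeOrientation n) : Prop :=
  IsUSO φ ∧
  ∀ (v : Vertex n) (C : Finset (Fin n)) (s t : Vertex n),
    IsSource φ v C s → IsSink φ v C t →
    ∃ P : Fin C.card → List (Vertex n),
      (∀ k, IsDirPathIn φ v C s t (P k)) ∧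
      ∀ k l, k ≠ l → ∀ u, u ∈ P k → u ∈ P l → u = s ∨ u = t

/-- `φ^{(F)}`: reverse all edges in the coordinates belonging to `F`. -/
def Reorient {n : ℕ} (φ : CubeOrientation n) (F : Finset (Fin n)) : CubeOrientation n :=
  fun v i => if i ∈ F then φ (vflip v i) i else φ v i

/-- Strong Holt–Klee property. -/
def StronglyHoltKlee {n : ℕ} (φ : CubeOrientation n) : Prop :=
  ∀ F : Finset (Fin n), HoltKlee (Reorient φ F)

/-- A P-matrix: all principal minors are positive. -/
def IsPMatrix {n : ℕ} (M : Matrix (Fin n) (Fin n) ℝ) : Prop :=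
  ∀ S : Finset (Fin n), S.Nonempty →
    0 < (M.submatrix (fun i : S => (i : Fin n)) (fun i : S => (i : Fin n))).det

/-- A Z-matrix: all off-diagonal entries are non-positive. -/
def IsZMatrix {n : ℕ} (M : Matrix (Fin n) (Fin n) ℝ) : Prop :=
  ∀ i j, i ≠ j → M i j ≤ 0

/-- A K-matrix: both a Z-matrix and a P-matrix. -/
def IsKMatrix {n : ℕ} (M : Matrix (Fin n) (Fin n) ℝ) : Prop :=
  IsZMatrix M ∧ IsPMatrix M

/-- The matrix `A_B`: its `s`-th column is the `s`-th column of `-M` if `s ∈ B`,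
and the `s`-th column of the identity matrix otherwise. -/
def ABmat {n : ℕ} (M : Matrix (Fin n) (Fin n) ℝ) (B : Finset (Fin n)) :
    Matrix (Fin n) (Fin n) ℝ :=
  fun r s => if s ∈ B then -(M r s) else if r = s then 1 else 0

/-- The vector `A_B⁻¹ q`. -/
noncomputable def lcpVal {n : ℕ} (M : Matrix (Fin n) (Fin n) ℝ) (q : Fin n → ℝ)
    (B : Finset (Fin n)) : Fin n → ℝ :=
  (ABmat M B)⁻¹ *ᵥ q

/-- `q` is nondegenerate for `M`: `(A_B⁻¹ q)_i ≠ 0` for all `B` and `i`. -/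
def Nondegenerate {n : ℕ} (M : Matrix (Fin n) (Fin n) ℝ) (q : Fin n → ℝ) : Prop :=
  ∀ (B : Finset (Fin n)) (i : Fin n), lcpVal M q B i ≠ 0

/-- `B(v) = {j : v_j = 1}`. -/
def vertexBasis {n : ℕ} (v : Vertex n) : Finset (Fin n) :=
  Finset.univ.filter (fun j => v j = true)

/-- The orientation induced by `LCP(M, q)`: `v → v ⊕ i` iff `(A_{B(v)}⁻¹ q)_i < 0`. -/
noncomputable def inducedOrientation {n : ℕ} (M : Matrix (Fin n) (Fin n) ℝ)
    (q : Fin n → ℝ) : CubeOrientation n :=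
  fun v i => decide (lcpVal M q (vertexBasis v) i < 0)

/-- A P-USO: an orientation induced by an LCP with a P-matrix and nondegenerate `q`. -/
def IsPUSO {n : ℕ} (φ : CubeOrientation n) : Prop :=
  ∃ (M : Matrix (Fin n) (Fin n) ℝ) (q : Fin n → ℝ),
    IsPMatrix M ∧ Nondegenerate M q ∧ φ = inducedOrientation M q

/-- A K-USO: an orientation induced by an LCP with a K-matrix and nondegenerate `q`. -/
def IsKUSO {n : ℕ} (φ : CubeOrientation n) : Prop :=
  ∃ (M : Matrix (Fin n) (Fin n) ℝ) (q : Fin n → ℝ),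
    IsKMatrix M ∧ Nondegenerate M q ∧ φ = inducedOrientation M q

/-- The `(n+1) × (n+1)` block matrix with upper-left block `M'`, last column
`(b; 1)` and last row `(0, …, 0, 1)`. -/
def blockM {n : ℕ} (M' : Matrix (Fin n) (Fin n) ℝ) (b : Fin n → ℝ) :
    Matrix (Fin (n + 1)) (Fin (n + 1)) ℝ :=
  fun r s =>
    if hr : r = Fin.last n then (if s = Fin.last n then 1 else 0)
    else if hs : s = Fin.last n then b (r.castPred hr)
    else M' (r.castPred hr) (s.castPred hs)

theorem blockM_last_castSucc {n : ℕ} (M' : Matrix (Fin n) (Fin n) ℝ) (b : Fin n → ℝ)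
    (s : Fin n) : blockM M' b (Fin.last n) s.castSucc = 0 := by
  simp [blockM]

theorem blockM_last_last {n : ℕ} (M' : Matrix (Fin n) (Fin n) ℝ) (b : Fin n → ℝ) :
    blockM M' b (Fin.last n) (Fin.last n) = 1 := by
  simp [blockM]

theorem blockM_castSucc_last {n : ℕ} (M' : Matrix (Fin n) (Fin n) ℝ) (b : Fin n → ℝ)
    (r : Fin n) : blockM M' b r.castSucc (Fin.last n) = b r := by
  simp [blockM]

theorem blockM_submatrix_castSucc {n : ℕ} (M' : Matrix (Fin n) (Fin n) ℝ) (b : Fin n → ℝ) :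
    (blockM M' b).submatrix Fin.castSucc Fin.castSucc = M' := by
  ext r s
  simp [blockM]

theorem ABmat_submatrix_castSucc {n : ℕ} (M : Matrix (Fin (n + 1)) (Fin (n + 1)) ℝ)
    (B : Finset (Fin (n + 1))) :
    (ABmat M B).submatrix Fin.castSucc Fin.castSucc =
      ABmat (M.submatrix Fin.castSucc Fin.castSucc)
        (Finset.univ.filter fun j : Fin n => j.castSucc ∈ B) := by
  ext r s
  simp [ABmat]

/-- Laplace expansion along a last row that vanishes off the diagonal. -/
theorem det_eq_of_last_row_castSucc_eq_zero {n : ℕ} {R : Type*} [CommRing R]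
    (A : Matrix (Fin (n + 1)) (Fin (n + 1)) R)
    (h : ∀ s : Fin n, A (Fin.last n) s.castSucc = 0) :
    A.det = A (Fin.last n) (Fin.last n) * (A.submatrix Fin.castSucc Fin.castSucc).det := by
  have hs : (Fin.last n).succAbove = Fin.castSucc := by
    ext i
    simp
  rw [det_succ_row A (Fin.last n), Fin.sum_univ_castSucc, hs]
  simp [h, ← two_mul, pow_mul]

/-- The determinant of `A_B` is the principal minor of `-M` indexed by `B`. -/
theorem det_ABmat {n : ℕ} (M : Matrix (Fin n) (Fin n) ℝ) (B : Finset (Fin n)) :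
    (ABmat M B).det =
      ((-M).submatrix (fun i : B => (i : Fin n)) (fun i : B => (i : Fin n))).det := by
  rw [twoBlockTriangular_det' (ABmat M B) (· ∈ B)]
  · have h1 : (ABmat M B).toSquareBlockProp (fun i => ¬ i ∈ B) = 1 := by
      ext ⟨r, hr⟩ ⟨s, hs⟩
      simp [toSquareBlockProp, ABmat, hs, one_apply]
    have h2 : (ABmat M B).toSquareBlockProp (· ∈ B) =
        (-M).submatrix (fun i : B => (i : Fin n)) (fun i : B => (i : Fin n)) := by
      ext ⟨r, hr⟩ ⟨s, hs⟩
      simp [toSquareBlockProp, ABmat, hs]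
    rw [h1, h2, det_one, mul_one]
    congr!
  · intro i hi j hj
    have hij : i ≠ j := fun h => hj (h ▸ hi)
    simp [ABmat, hj, hij]

theorem IsPMatrix.det_ABmat_neg_pos {n : ℕ} {M : Matrix (Fin n) (Fin n) ℝ}
    (hM : IsPMatrix M) (B : Finset (Fin n)) : 0 < (ABmat (-M) B).det := by
  rw [det_ABmat, neg_neg]
  rcases B.eq_empty_or_nonempty with rfl | hB
  · simp
  · exact hM B hB

theorem IsPMatrix.isUnit_det_ABmat {n : ℕ} {M : Matrix (Fin n) (Fin n) ℝ}
    (hM : IsPMatrix M) (B : Finset (Fin n)) : IsUnit (ABmat M B).det := by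
  have h := hM.det_ABmat_neg_pos B
  rw [det_ABmat, neg_neg] at h
  rw [det_ABmat, submatrix_neg, Pi.neg_apply, Pi.neg_apply, det_neg]
  exact ((isUnit_one.neg).pow _).mul h.ne'.isUnit

theorem isPMatrix_blockM {n : ℕ} {M' : Matrix (Fin n) (Fin n) ℝ}
    (hM' : IsPMatrix M') (b : Fin n → ℝ) : IsPMatrix (blockM M' b) := by
  intro S _
  have h := det_ABmat (-blockM M' b) S
  rw [neg_neg] at h
  rw [← h, det_eq_of_last_row_castSucc_eq_zero, ABmat_submatrix_castSucc]
  · have h1 : ABmat (-blockM M' b) S (Fin.last n) (Fin.last n) = 1 := by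
      simp [ABmat, blockM_last_last]
    have h2 : (-blockM M' b).submatrix Fin.castSucc Fin.castSucc = -M' :=
      congrArg Neg.neg (blockM_submatrix_castSucc M' b)
    rw [h1, h2, one_mul]
    exact hM'.det_ABmat_neg_pos _
  · intro s
    simp [ABmat, blockM_last_castSucc, (Fin.castSucc_lt_last s).ne']

theorem IsPMatrix.ABmat_mulVec_lcpVal {n : ℕ} {M : Matrix (Fin n) (Fin n) ℝ}
    (hM : IsPMatrix M) (q : Fin n → ℝ) (B : Finset (Fin n)) :
    ABmat M B *ᵥ lcpVal M q B = q := by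
  rw [lcpVal, mulVec_mulVec, mul_nonsing_inv _ (hM.isUnit_det_ABmat B), one_mulVec]

theorem IsPMatrix.eq_lcpVal {n : ℕ} {M : Matrix (Fin n) (Fin n) ℝ}
    (hM : IsPMatrix M) {q x : Fin n → ℝ} {B : Finset (Fin n)}
    (h : ABmat M B *ᵥ x = q) : x = lcpVal M q B := by
  rw [lcpVal, ← h, mulVec_mulVec, nonsing_inv_mul _ (hM.isUnit_det_ABmat B), one_mulVec]

theorem lcpVal_blockM_castSucc {n : ℕ} {M' : Matrix (Fin n) (Fin n) ℝ}
    (hM' : IsPMatrix M') (b : Fin n → ℝ) (q : Fin (n + 1) → ℝ) {v : Vertex (n + 1)}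
    (hv : v (Fin.last n) = true) (i : Fin n) :
    lcpVal (blockM M' b) q (vertexBasis v) i.castSucc =
      lcpVal M' (fun j => q j.castSucc - q (Fin.last n) * b j)
        (vertexBasis (fun j => v j.castSucc)) i := by
  set x := lcpVal (blockM M' b) q (vertexBasis v) with hx
  have hAx : ABmat (blockM M' b) (vertexBasis v) *ᵥ x = q :=
    (isPMatrix_blockM hM' b).ABmat_mulVec_lcpVal q _
  have hlast : -x (Fin.last n) = q (Fin.last n) := by
    rw [← congrFun hAx (Fin.last n), mulVec, dotProduct, Fin.sum_univ_castSucc]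
    simp [ABmat, blockM_last_castSucc, blockM_last_last, vertexBasis, hv,
      (Fin.castSucc_lt_last _).ne']
  refine congrFun (hM'.eq_lcpVal (x := fun j => x j.castSucc) ?_) i
  ext r
  have hr := congrFun hAx r.castSucc
  rw [mulVec, dotProduct, Fin.sum_univ_castSucc] at hr
  have hcol : ABmat (blockM M' b) (vertexBasis v) r.castSucc (Fin.last n) = -b r := by
    simp [ABmat, vertexBasis, hv, blockM_castSucc_last]
  have hsub : ∀ s : Fin n, ABmat (blockM M' b) (vertexBasis v) r.castSucc s.castSucc =
      ABmat M' (vertexBasis fun j => v j.castSucc) r s := by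
    intro s
    simp [ABmat, vertexBasis, blockM]
  simp only [hcol, hsub] at hr
  rw [mulVec, dotProduct, ← hr, ← hlast]
  ring

theorem stmt16 (n : ℕ) (hn : 1 ≤ n) (M' : Matrix (Fin n) (Fin n) ℝ)
    (hM' : IsPMatrix M') (b : Fin n → ℝ) :
    IsPMatrix (blockM M' b) ∧
    ∀ (q : Fin (n + 1) → ℝ) (v : Vertex (n + 1)), v (Fin.last n) = true →
      (∀ i : Fin n,
        lcpVal (blockM M' b) q (vertexBasis v) i.castSucc =
          lcpVal M' (fun j => q j.castSucc - q (Fin.last n) * b j)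
            (vertexBasis (fun j => v j.castSucc)) i) ∧
      (∀ i : Fin n,
        inducedOrientation (blockM M' b) q v i.castSucc =
          inducedOrientation M' (fun j => q j.castSucc - q (Fin.last n) * b j)
            (fun j => v j.castSucc) i) := by
  refine ⟨isPMatrix_blockM hM' b, fun q v hv => ⟨lcpVal_blockM_castSucc hM' b q hv, fun i => ?_⟩⟩
  simp only [inducedOrientation, lcpVal_blockM_castSucc hM' b q hv]
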